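/- There is no measurable function F : (0,1] → ℝ with ∫₀¹ F(v)² dv < ∞ such that ∫₀¹ F(v)·F(x·v) dv = x^{−1/2} for all x ∈ (0,1]. -/

import Mathlib

open Real MeasureTheory

/-- If `F` is normalized in `L²(0,1)` and its `L²`-dilation by `x` has inner product `1` with `F`,
then all the mass of `F ^ 2` lies in `(0, x]`. -/
theorem one_le_integral_sq_of_integral_mul_dilation {F : ℝ → ℝ}
    (hint : IntervalIntegrable (fun v => F v ^ 2) volume 0 1)
    (hnorm : ∫ v in (0 : ℝ)..1, F v ^ 2 = 1) {x : ℝ} (hx : 0 < x) (hx1 : x ≤ 1)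
    (hF : ∫ v in (0 : ℝ)..1, F v * F (x * v) = x ^ (-(1 / 2) : ℝ)) :
    1 ≤ ∫ v in (0 : ℝ)..x, F v ^ 2 := by
  have hpos : 0 < x ^ (-(1 / 2) : ℝ) := rpow_pos_of_pos hx _
  have hmul : √x * x ^ (-(1 / 2) : ℝ) = 1 := by
    rw [sqrt_eq_rpow, ← rpow_add hx]
    norm_num
  have hcross : IntervalIntegrable (fun v => F v * F (x * v)) volume 0 1 :=
    intervalIntegral.intervalIntegrable_of_integral_ne_zero (by rw [hF]; exact hpos.ne')
  have hdil : IntervalIntegrable (fun v => F (x * v) ^ 2) volume 0 1 := by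
    have hsub : IntervalIntegrable (fun v => F v ^ 2) volume 0 x :=
      hint.mono_set (by
        rw [Set.uIcc_of_le hx.le, Set.uIcc_of_le zero_le_one]
        exact Set.Icc_subset_Icc_right hx1)
    simpa [hx.ne'] using hsub.comp_mul_left (c := x)
  have hdil_eq : x * ∫ v in (0 : ℝ)..1, F (x * v) ^ 2 = ∫ v in (0 : ℝ)..x, F v ^ 2 := by
    simpa using intervalIntegral.mul_integral_comp_mul_left (a := 0) (b := 1)
      (f := fun v => F v ^ 2) (c := x)
  have hmono : ∫ v in (0 : ℝ)..1, 2 * √x * (F v * F (x * v)) ≤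
      ∫ v in (0 : ℝ)..1, (F v ^ 2 + x * F (x * v) ^ 2) := by
    refine intervalIntegral.integral_mono_on zero_le_one (hcross.const_mul _)
      (hint.add (hdil.const_mul _)) fun v _ => ?_
    nlinarith [sq_nonneg (F v - √x * F (x * v)), sq_sqrt hx.le]
  rw [intervalIntegral.integral_add hint (hdil.const_mul _), intervalIntegral.integral_const_mul,
    intervalIntegral.integral_const_mul, hF, hnorm, hdil_eq, mul_assoc, hmul] at hmono
  linarith

/-- There is no square-integrable `F` on `(0,1]` with `∫₀¹ F(v) F(xv) dv = x^{-1/2}` for all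
`x ∈ (0,1]`; i.e., the degenerate process `t^H W(1)` has no Volterra representation. -/
theorem no_volterra_representation :
    ¬ ∃ F : ℝ → ℝ, Measurable F ∧
      IntegrableOn (fun v => (F v) ^ 2) (Set.Ioc (0 : ℝ) 1) ∧
      ∀ x : ℝ, 0 < x → x ≤ 1 →
        (∫ v in (0 : ℝ)..1, F v * F (x * v)) = x ^ (-(1/2) : ℝ) := by
  rintro ⟨F, -, hint, hF⟩
  have hint' : IntervalIntegrable (fun v => F v ^ 2) volume 0 1 :=
    (intervalIntegrable_iff_integrableOn_Ioc_of_le zero_le_one).2 hint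
  have hnorm : ∫ v in (0 : ℝ)..1, F v ^ 2 = 1 := by
    simpa [sq] using hF 1 one_pos le_rfl
  have hcont : ContinuousOn (fun x => ∫ v in (0 : ℝ)..x, F v ^ 2) (Set.uIcc 0 1) :=
    intervalIntegral.continuousOn_primitive_interval' hint' Set.left_mem_uIcc
  have hlim : Filter.Tendsto (fun x => ∫ v in (0 : ℝ)..x, F v ^ 2)
      (nhdsWithin 0 (Set.Ioc 0 1)) (nhds 0) := by
    have h := (hcont 0 Set.left_mem_uIcc).mono (s := Set.Ioc 0 1) (by
      rw [Set.uIcc_of_le zero_le_one]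
      exact Set.Ioc_subset_Icc_self)
    simpa [ContinuousWithinAt] using h
  have hbot : (nhdsWithin (0 : ℝ) (Set.Ioc 0 1)).NeBot := by
    rw [nhdsWithin_Ioc_eq_nhdsGT one_pos]
    infer_instance
  have hle : (1 : ℝ) ≤ 0 := ge_of_tendsto hlim <| by
    filter_upwards [self_mem_nhdsWithin] with x hx
    exact one_le_integral_sq_of_integral_mul_dilation hint' hnorm hx.1 hx.2 (hF x hx.1 hx.2)
  exact absurd hle (by norm_num)
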